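/- The following two conditions are equivalent: (a) [Condition G] for every i ∈ {1,…,m}, gⁱ·nⁱ > 0, and for every x⁰ ∈ ∂D there exists a unit vector e ∈ N(x⁰) such that e·g > 0 for every g ∈ G(x⁰)∖{0}; (b) [Assumption 1.1 of Dai and Williams, two-dimensional form] for every x⁰ ∈ ∂D there exist nonnegative reals ηᵢ, i ∈ I(x⁰), such that the vector e := Σ_{i∈I(x⁰)} ηᵢ nⁱ satisfies e·gʲ > 0 for all j ∈ I(x⁰). -/

import Mathlib

open Set Filter
open scoped RealInnerProductSpace Topology

section Cones

variable {ι E : Type*} [NormedAddCommGroup E] [InnerProductSpace ℝ E]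

/-- Approximate Farkas lemma: a vector nonnegative on the dual of a finite family is a limit of
conic combinations of the family. -/
lemma mem_closure_hull_of_forall_inner_nonneg [CompleteSpace E] {s : Set E} {e : E}
    (h : ∀ u : E, (∀ v ∈ s, 0 ≤ ⟪v, u⟫) → 0 ≤ ⟪e, u⟫) :
    e ∈ closure (PointedCone.hull ℝ s : Set E) := by
  by_contra hcon
  obtain ⟨u, hu, heu⟩ := ProperCone.hyperplane_separation'
    (Submodule.closure (PointedCone.hull ℝ s)) (x₀ := e) hcon
  exact absurd (h u fun v hv => hu v (subset_closure (PointedCone.subset_hull hv)))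
    (not_le.2 heu)

/-- If `e` is nonnegative on the dual of the vectors `n i`, `i ∈ s`, and positive on finitely many
vectors, then some conic combination of these `n i` is positive on the same vectors. -/
lemma exists_conic_combination_pos [CompleteSpace E] {κ : Type*} [Finite κ] [Fintype ι]
    {n : ι → E} {P : ι → Prop} {e : E} (he : ∀ u : E, (∀ i, P i → 0 ≤ ⟪n i, u⟫) → 0 ≤ ⟪e, u⟫)
    {g : κ → E} {Q : κ → Prop} (hg : ∀ j, Q j → 0 < ⟪e, g j⟫) :
    ∃ η : ι → ℝ, (∀ i, 0 ≤ η i) ∧ (∀ i, ¬ P i → η i = 0) ∧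
      ∀ j, Q j → 0 < ⟪∑ i, η i • n i, g j⟫ := by
  classical
  have hopen : ∀ᶠ x in 𝓝 e, ∀ j, Q j → 0 < ⟪x, g j⟫ := by
    refine eventually_all.2 fun j => ?_
    by_cases hj : Q j
    · have hc : Continuous fun x : E => ⟪x, g j⟫ := by fun_prop
      filter_upwards [hc.continuousAt.eventually (lt_mem_nhds (hg j hj))] with x hx _ using hx
    · exact Eventually.of_forall fun _ h => absurd h hj
  have hcl : e ∈ closure
      (PointedCone.hull ℝ (n '' (↑(Finset.univ.filter P) : Set ι)) : Set E) :=
    mem_closure_hull_of_forall_inner_nonneg fun u hu => he u fun i hi =>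
      hu _ (mem_image_of_mem _ (by simpa using hi))
  obtain ⟨x, hx, hxs⟩ := ((mem_closure_iff_frequently.1 hcl).and_eventually hopen).exists
  obtain ⟨c, rfl⟩ := (Submodule.mem_span_image_finset_iff_exists_fun' NNReal).1 hx
  refine ⟨fun i => if P i then (c i : ℝ) else 0, fun i => ?_, fun i hi => if_neg hi, ?_⟩
  · dsimp only
    split_ifs
    exacts [(c i).2, le_rfl]
  · rw [Finset.sum_filter] at hxs
    simp only [ite_smul, zero_smul]
    exact hxs

/-- The difference quotient in the definition of the inward normal cone is bounded by `‖e‖`. -/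
lemma abs_inner_unit_smul_le (w e : E) : |⟪‖w‖⁻¹ • w, e⟫| ≤ ‖e‖ := by
  refine (abs_real_inner_le_norm _ _).trans (mul_le_of_le_one_left (norm_nonneg _) ?_)
  rw [norm_smul, norm_inv, norm_norm]
  exact inv_mul_le_one

/-- An inward normal at `x0` has nonnegative inner product with every direction in which a
segment starting at `x0` stays in `S`. -/
lemma inner_nonneg_of_liminf_nonneg {S : Set E} {x0 w e : E}
    (he : 0 ≤ liminf (fun x => ⟪‖x - x0‖⁻¹ • (x - x0), e⟫) (𝓝[S \ {x0}] x0))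
    (hw : ∀ᶠ t : ℝ in 𝓝[>] 0, x0 + t • w ∈ S) : 0 ≤ ⟪w, e⟫ := by
  rcases eq_or_ne w 0 with rfl | hw0
  · simp
  have htend : Tendsto (fun t : ℝ => x0 + t • w) (𝓝[>] 0) (𝓝[S \ {x0}] x0) := by
    refine tendsto_nhdsWithin_iff.2 ⟨?_, ?_⟩
    · have hc : Continuous fun t : ℝ => x0 + t • w := by fun_prop
      simpa using (hc.tendsto 0).mono_left nhdsWithin_le_nhds
    · filter_upwards [hw, self_mem_nhdsWithin] with t ht htpos
      exact ⟨ht, by simpa [hw0] using (ne_of_gt htpos : t ≠ 0)⟩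
  have hfreq : ∃ᶠ x in 𝓝[S \ {x0}] x0,
      ⟪‖x - x0‖⁻¹ • (x - x0), e⟫ ≤ ⟪‖w‖⁻¹ • w, e⟫ := by
    refine htend.frequently (Eventually.frequently ?_)
    filter_upwards [self_mem_nhdsWithin] with t ht
    have ht : (0 : ℝ) < t := ht
    refine le_of_eq ?_
    rw [add_sub_cancel_left, norm_smul, Real.norm_of_nonneg ht.le, smul_smul, mul_inv,
      mul_right_comm, inv_mul_cancel₀ ht.ne', one_mul]
  have hle := he.trans (liminf_le_of_frequently_le hfreq
    (isBoundedUnder_of ⟨-‖e‖, fun x => (abs_le.1 (abs_inner_unit_smul_le (x - x0) e)).1⟩))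
  rw [real_inner_smul_left] at hle
  exact nonneg_of_mul_nonneg_right hle (inv_pos.2 (norm_pos_iff.2 hw0))

/-- A vector with nonnegative inner product with `x - x0` for all `x ∈ S` is an inward normal
of `S` at `x0`. -/
lemma liminf_nonneg_of_inner_nonneg {S : Set E} {x0 e : E}
    [(𝓝[S \ {x0}] x0).NeBot] (he : ∀ x ∈ S, 0 ≤ ⟪x - x0, e⟫) :
    0 ≤ liminf (fun x => ⟪‖x - x0‖⁻¹ • (x - x0), e⟫) (𝓝[S \ {x0}] x0) := by
  refine le_liminf_of_le (IsBoundedUnder.isCoboundedUnder_ge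
    (isBoundedUnder_of ⟨‖e‖, fun x => (abs_le.1 (abs_inner_unit_smul_le (x - x0) e)).2⟩)) ?_
  filter_upwards [self_mem_nhdsWithin] with x hx
  rw [real_inner_smul_left]
  exact mul_nonneg (inv_nonneg.2 (norm_nonneg _)) (he x hx.1)

end Cones

section Polyhedra

variable {ι E : Type*} [NormedAddCommGroup E] [InnerProductSpace ℝ E] {n : ι → E} {b : ι → ℝ}

lemma isOpen_iInter_halfSpaces [Finite ι] : IsOpen (⋂ i, {x : E | b i < ⟪x, n i⟫}) :=
  isOpen_iInter_of_finite fun _ =>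
    isOpen_lt continuous_const (continuous_id.inner continuous_const)

lemma le_inner_of_mem_closure {x : E} (hx : x ∈ closure (⋂ i, {x : E | b i < ⟪x, n i⟫}))
    (i : ι) : b i ≤ ⟪x, n i⟫ := by
  have hcl : IsClosed {x : E | b i ≤ ⟪x, n i⟫} :=
    isClosed_le continuous_const (continuous_id.inner continuous_const)
  refine closure_minimal (fun y hy => ?_) hcl hx
  exact (show b i < ⟪y, n i⟫ from mem_iInter.1 hy i).le

lemma exists_inner_eq_of_mem_frontier [Finite ι] {x : E}
    (hx : x ∈ frontier (⋂ i, {x : E | b i < ⟪x, n i⟫})) : ∃ i, ⟪x, n i⟫ = b i := by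
  rw [isOpen_iInter_halfSpaces.frontier_eq] at hx
  by_contra! hne
  exact hx.2 (mem_iInter.2 fun i => lt_of_le_of_ne (le_inner_of_mem_closure hx.1 i) (hne i).symm)

/-- A direction pointing strictly inward with respect to all active constraints enters the
polyhedron. -/
lemma eventually_add_smul_mem [Finite ι] {x0 w : E} (hx0 : ∀ i, b i ≤ ⟪x0, n i⟫)
    (hw : ∀ i, ⟪x0, n i⟫ = b i → 0 < ⟪w, n i⟫) :
    ∀ᶠ t : ℝ in 𝓝[>] 0, x0 + t • w ∈ ⋂ i, {x : E | b i < ⟪x, n i⟫} := by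
  simp only [mem_iInter]
  refine eventually_all.2 fun i => ?_
  rcases (hx0 i).eq_or_lt with hi | hi
  · filter_upwards [self_mem_nhdsWithin] with t ht
    have := mul_pos (show (0 : ℝ) < t from ht) (hw i hi.symm)
    simp only [inner_add_left, real_inner_smul_left]
    linarith
  · have hc : Continuous fun t : ℝ => ⟪x0 + t • w, n i⟫ := by fun_prop
    exact nhdsWithin_le_nhds (hc.continuousAt.eventually (lt_mem_nhds (by simpa using hi)))

lemma neBot_nhdsWithin_of_le_inner [Finite ι] (hne : (⋂ i, {x : E | b i < ⟪x, n i⟫}).Nonempty)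
    {x0 : E} (hx0 : ∀ i, b i ≤ ⟪x0, n i⟫) :
    (𝓝[(⋂ i, {x : E | b i < ⟪x, n i⟫})] x0).NeBot := by
  obtain ⟨d, hd⟩ := hne
  have hd : ∀ i, b i < ⟪d, n i⟫ := fun i => mem_iInter.1 hd i
  have hev := eventually_add_smul_mem (w := d - x0) hx0 fun i hi => by
    rw [inner_sub_left, hi]; exact sub_pos.2 (hd i)
  have hc : Continuous fun t : ℝ => x0 + t • (d - x0) := by fun_prop
  refine (tendsto_nhdsWithin_iff.2 ⟨?_, hev⟩).neBot
  simpa using (hc.tendsto 0).mono_left nhdsWithin_le_nhds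

/-- An inward normal at a boundary point is nonnegative on the dual of the active normals. -/
lemma inner_nonneg_of_normal [Finite ι] (hne : (⋂ i, {x : E | b i < ⟪x, n i⟫}).Nonempty)
    {x0 e : E} (hx0 : ∀ i, b i ≤ ⟪x0, n i⟫)
    (he : 0 ≤ liminf (fun x => ⟪‖x - x0‖⁻¹ • (x - x0), e⟫)
      (𝓝[closure (⋂ i, {x : E | b i < ⟪x, n i⟫}) \ {x0}] x0))
    {u : E} (hu : ∀ i, ⟪x0, n i⟫ = b i → 0 ≤ ⟪n i, u⟫) : 0 ≤ ⟪e, u⟫ := by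
  obtain ⟨d, hd⟩ := hne
  have hd : ∀ i, b i < ⟪d, n i⟫ := fun i => mem_iInter.1 hd i
  have hpos : ∀ᶠ s : ℝ in 𝓝[>] 0, 0 ≤ ⟪u + s • (d - x0), e⟫ := by
    filter_upwards [self_mem_nhdsWithin] with s hs
    refine inner_nonneg_of_liminf_nonneg he ((eventually_add_smul_mem hx0 fun i hi => ?_).mono
      fun t ht => subset_closure ht)
    have h1 := hu i hi
    have h2 := mul_pos (show (0 : ℝ) < s from hs) (sub_pos.2 (hd i))
    rw [real_inner_comm] at h1
    rw [inner_add_left, real_inner_smul_left, inner_sub_left, hi]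
    linarith
  have hc : Continuous fun s : ℝ => ⟪u + s • (d - x0), e⟫ := by fun_prop
  have hlim := (hc.tendsto 0).mono_left (nhdsWithin_le_nhds (s := Ioi 0))
  rw [real_inner_comm]
  simpa using ge_of_tendsto hlim hpos

/-- In a minimal representation every constraint is the only active one at some boundary
point. -/
lemma exists_mem_frontier_unique_active [Finite ι]
    (hne : (⋂ i, {x : E | b i < ⟪x, n i⟫}).Nonempty) {j : ι}
    (hj : (⋂ i, {x : E | b i < ⟪x, n i⟫}) ⊂ ⋂ (i) (_ : i ≠ j), {x : E | b i < ⟪x, n i⟫}) :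
    ∃ x ∈ frontier (⋂ i, {x : E | b i < ⟪x, n i⟫}),
      ⟪x, n j⟫ = b j ∧ ∀ i, i ≠ j → b i < ⟪x, n i⟫ := by
  obtain ⟨y, hy, hyD⟩ := exists_of_ssubset hj
  simp only [mem_iInter, mem_ofPred_eq] at hy
  have hyj : ⟪y, n j⟫ ≤ b j := by
    by_contra! hlt
    refine hyD (mem_iInter.2 fun i => ?_)
    rcases eq_or_ne i j with rfl | hij
    exacts [hlt, hy i hij]
  obtain ⟨d, hd'⟩ := id hne
  have hd : ∀ i, b i < ⟪d, n i⟫ := fun i => mem_iInter.1 hd' i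
  have hden : 0 < ⟪d, n j⟫ - ⟪y, n j⟫ := by linarith [hd j]
  set t : ℝ := (⟪d, n j⟫ - b j) / (⟪d, n j⟫ - ⟪y, n j⟫) with ht
  have ht0 : 0 < t := div_pos (sub_pos.2 (hd j)) hden
  have ht1 : t ≤ 1 := (div_le_one hden).2 (by linarith)
  have hx : ∀ i, ⟪d + t • (y - d), n i⟫ = (1 - t) * ⟪d, n i⟫ + t * ⟪y, n i⟫ := fun i => by
    rw [inner_add_left, real_inner_smul_left, inner_sub_left]; ring
  have hxj : ⟪d + t • (y - d), n j⟫ = b j := by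
    have := div_mul_cancel₀ (⟪d, n j⟫ - b j) hden.ne'
    rw [← ht] at this
    rw [hx]; linarith
  have hxi : ∀ i, i ≠ j → b i < ⟪d + t • (y - d), n i⟫ := fun i hij => by
    rw [hx]
    nlinarith [hd i, hy i hij, mul_pos ht0 (sub_pos.2 (hy i hij)),
      mul_nonneg (sub_nonneg.2 ht1) (sub_pos.2 (hd i)).le]
  refine ⟨d + t • (y - d), ?_, hxj, hxi⟩
  rw [isOpen_iInter_halfSpaces.frontier_eq]
  refine ⟨mem_closure_iff_nhdsWithin_neBot.2 (neBot_nhdsWithin_of_le_inner hne fun i => ?_),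
    fun hmem => absurd (mem_iInter.1 hmem j) ?_⟩
  · rcases eq_or_ne i j with rfl | hij
    exacts [hxj.ge, (hxi i hij).le]
  · simp [hxj]

end Polyhedra

/-- Let `D ⊆ ℝ²` be a nonempty bounded polygon given by a
minimal representation `D = ⋂ i, {x | x ⬝ nⁱ > bᵢ}` with distinct unit
normals, and let `gⁱ` be unit vectors (constant reflection directions).
With `I(x0) = {i | x0 ⬝ nⁱ = bᵢ}`, the inward normal cone
`N(x0) = {v | liminf_{x → x0, x ∈ closure D \ {x0}} ((x - x0)/‖x - x0‖) ⬝ v ≥ 0}`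
and the reflection cone `G(x0) = {∑_{i ∈ I(x0)} ηᵢ gⁱ | ηᵢ ≥ 0}`,
the following are equivalent:
(a) `gⁱ ⬝ nⁱ > 0` for every `i`, and for every `x0 ∈ ∂D` there is a unit
vector `e ∈ N(x0)` with `e ⬝ g > 0` for every `g ∈ G(x0) \ {0}`;
(b) for every `x0 ∈ ∂D` there are `ηᵢ ≥ 0`, supported on `I(x0)`, such that
`e := ∑ᵢ ηᵢ nⁱ` satisfies `e ⬝ gʲ > 0` for all `j ∈ I(x0)`. -/
theorem conditionG_iff_daiWilliams
    {m : ℕ} (n : Fin m → EuclideanSpace ℝ (Fin 2)) (b : Fin m → ℝ)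
    (g : Fin m → EuclideanSpace ℝ (Fin 2))
    (hunit : ∀ i, ‖n i‖ = 1) (hdist : Function.Injective n)
    (hgunit : ∀ i, ‖g i‖ = 1)
    (D : Set (EuclideanSpace ℝ (Fin 2)))
    (hD : D = ⋂ i, {x | b i < ⟪x, n i⟫})
    (hne : D.Nonempty) (hbdd : Bornology.IsBounded D)
    (hmin : ∀ j, D ⊂ ⋂ (i) (_ : i ≠ j), {x | b i < ⟪x, n i⟫}) :
    ((∀ i, 0 < ⟪g i, n i⟫) ∧
      ∀ x0 ∈ frontier D, ∃ e : EuclideanSpace ℝ (Fin 2), ‖e‖ = 1 ∧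
        0 ≤ liminf (fun x => ⟪‖x - x0‖⁻¹ • (x - x0), e⟫) (𝓝[closure D \ {x0}] x0) ∧
        ∀ v : EuclideanSpace ℝ (Fin 2),
          (∃ η : Fin m → ℝ, (∀ i, 0 ≤ η i) ∧ (∀ i, ⟪x0, n i⟫ ≠ b i → η i = 0) ∧
            v = ∑ i, η i • g i) → v ≠ 0 → 0 < ⟪e, v⟫) ↔
      (∀ x0 ∈ frontier D, ∃ η : Fin m → ℝ, (∀ i, 0 ≤ η i) ∧
        (∀ i, ⟪x0, n i⟫ ≠ b i → η i = 0) ∧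
        ∀ j, ⟪x0, n j⟫ = b j → 0 < ⟪∑ i, η i • n i, g j⟫) := by
  subst hD
  constructor
  · rintro ⟨-, hG⟩ x0 hx0
    obtain ⟨e, -, heN, heG⟩ := hG x0 hx0
    refine exists_conic_combination_pos (P := fun i => ⟪x0, n i⟫ = b i) (fun u hu =>
      inner_nonneg_of_normal hne (le_inner_of_mem_closure hx0.1) heN hu) fun j hj => ?_
    refine heG (g j) ⟨Pi.single j 1, fun i => ?_, fun i hi => ?_, ?_⟩ ?_
    · exact (Pi.single_nonneg.2 zero_le_one : (0 : Fin m → ℝ) ≤ Pi.single j 1) i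
    · exact Pi.single_eq_of_ne (by rintro rfl; exact hi hj) _
    · simp [Pi.single_apply]
    · exact norm_ne_zero_iff.1 (by simp [hgunit])
  · intro hDW
    refine ⟨fun j => ?_, fun x0 hx0 => ?_⟩
    · obtain ⟨x0, hx0, hxj, hxi⟩ := exists_mem_frontier_unique_active hne (hmin j)
      obtain ⟨η, hη, hη0, hpos⟩ := hDW x0 hx0
      have hj := hpos j hxj
      rw [Finset.sum_eq_single j (fun i _ hij => by rw [hη0 i (hxi i hij).ne', zero_smul])
        (by simp), real_inner_smul_left, real_inner_comm] at hj
      exact pos_of_mul_pos_right hj (hη j)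
    · obtain ⟨η, hη, hη0, hpos⟩ := hDW x0 hx0
      obtain ⟨k, hk⟩ := exists_inner_eq_of_mem_frontier hx0
      set e := ∑ i, η i • n i with he
      have he0 : e ≠ 0 := fun h => by simpa [h] using hpos k hk
      have hinv : 0 < ‖e‖⁻¹ := inv_pos.2 (norm_pos_iff.2 he0)
      refine ⟨‖e‖⁻¹ • e, norm_smul_inv_norm he0, ?_, ?_⟩
      · have hx0D : x0 ∉ ⋂ i, {x | b i < ⟪x, n i⟫} := fun h =>
          absurd (mem_iInter.1 h k) (by simp [hk])
        have := neBot_nhdsWithin_of_le_inner hne (le_inner_of_mem_closure hx0.1)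
        have : (𝓝[closure (⋂ i, {x | b i < ⟪x, n i⟫}) \ {x0}] x0).NeBot :=
          NeBot.mono this (nhdsWithin_mono _ fun y hy =>
            ⟨subset_closure hy, fun h => hx0D (h ▸ hy)⟩)
        refine liminf_nonneg_of_inner_nonneg fun x hx => ?_
        rw [real_inner_smul_right, he, inner_sum]
        refine mul_nonneg hinv.le (Finset.sum_nonneg fun i _ => ?_)
        rw [real_inner_smul_right]
        by_cases hi : ⟪x0, n i⟫ = b i
        · rw [inner_sub_left, hi]
          exact mul_nonneg (hη i) (sub_nonneg.2 (le_inner_of_mem_closure hx i))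
        · simp [hη0 i hi]
      · rintro v ⟨c, hc, hc0, rfl⟩ hv
        rw [real_inner_smul_left, inner_sum]
        refine mul_pos hinv ?_
        have hterm : ∀ i ∈ Finset.univ, 0 ≤ ⟪e, c i • g i⟫ := fun i _ => by
          rw [real_inner_smul_right]
          by_cases hi : ⟪x0, n i⟫ = b i
          · exact mul_nonneg (hc i) (hpos i hi).le
          · simp [hc0 i hi]
        obtain ⟨i, -, hi⟩ := Finset.exists_ne_zero_of_sum_ne_zero hv
        have hci : c i ≠ 0 := fun h => hi (by rw [h, zero_smul])
        refine Finset.sum_pos' hterm ⟨i, Finset.mem_univ i, ?_⟩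
        rw [real_inner_smul_right]
        exact mul_pos ((hc i).lt_of_ne' hci) (hpos i (not_not.1 fun h => hci (hc0 i h)))
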